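/- Let S ≤ S' be additive submonoids of ℕ with the pair (S, S') equi-gcd and F(S'/S) = {w} (Frobenius type one). Then Nat.card (G(S'/S)) ≥ Nat.card (N(S'/S)) + Nat.card (PF(S'/S)) - 1. -/

import Mathlib

/-- The pair `(S, S')` is equi-gcd: a natural number divides every element of `S`
iff it divides every element of `S'`. -/
def EquiGcd (S S' : AddSubmonoid ℕ) : Prop :=
  ∀ d : ℕ, (∀ x ∈ S, d ∣ x) ↔ (∀ x ∈ S', d ∣ x)

/-- The gap set `G(S'/S) = S' \ S`. -/
def gapSet (S S' : AddSubmonoid ℕ) : Set ℕ := (S' : Set ℕ) \ (S : Set ℕ)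

/-- The sporadic set `N(S'/S)` of elements of `S` not in the conductor. -/
def sporadicSet (S S' : AddSubmonoid ℕ) : Set ℕ :=
  {a : ℕ | a ∈ S ∧ ∃ t ∈ S', a + t ∉ S}

/-- The pseudo-Frobenius set `PF(S'/S)`. -/
def pseudoFrobSet (S S' : AddSubmonoid ℕ) : Set ℕ :=
  {w : ℕ | w ∈ S' ∧ w ∉ S ∧ ∀ s ∈ S, s ≠ 0 → w + s ∈ S}

/-- The Frobenius set `F(S'/S)`. -/
def frobSet (S S' : AddSubmonoid ℕ) : Set ℕ :=
  {w : ℕ | w ∈ S' ∧ w ∉ S ∧ ∀ t ∈ S', t ≠ 0 → w + t ∈ S}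

/-- `S` is irreducible in `S'`. -/
def IrreducibleIn (S S' : AddSubmonoid ℕ) : Prop :=
  ∀ T₁ T₂ : AddSubmonoid ℕ, S ≤ T₁ → T₁ ≤ S' → S ≤ T₂ → T₂ ≤ S' →
    T₁ ⊓ T₂ = S → T₁ = S ∨ T₂ = S

/-- The fundamental gap set `FG(S'/S)`. -/
def fundGapSet (S S' : AddSubmonoid ℕ) : Set ℕ :=
  {t : ℕ | t ∈ S' ∧ t ∉ S ∧ 2 * t ∈ S ∧ 3 * t ∈ S}

/-- An equi-gcd pair has a finite gap set. -/
theorem EquiGcd.finite_gapSet {S S' : AddSubmonoid ℕ} (h : EquiGcd S S') :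
    (gapSet S S').Finite := by
  obtain ⟨n, hn⟩ := Nat.exists_mem_closure_of_ge (S : Set ℕ)
  refine (Set.finite_lt_nat n).subset fun x hx => ?_
  by_contra hxn
  refine hx.2 ?_
  have hdvd := (h (Nat.setGcd (S : Set ℕ))).1 (fun y hy => Nat.setGcd_dvd_of_mem hy) x hx.1
  simpa using hn x (not_lt.1 hxn) hdvd

/-- Every gap lies below a Frobenius element with respect to the order of `S'`. -/
theorem exists_add_mem_frobSet {S S' : AddSubmonoid ℕ} (hfin : (gapSet S S').Finite)
    {g : ℕ} (hg : g ∈ gapSet S S') : ∃ t ∈ S', g + t ∈ frobSet S S' := by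
  have hfin' : {x ∈ gapSet S S' | ∃ t ∈ S', g + t = x}.Finite := hfin.subset fun x hx => hx.1
  obtain ⟨m, ⟨hm, t, ht, rfl⟩, hmax⟩ :=
    hfin'.exists_maximal ⟨g, hg, 0, S'.zero_mem, add_zero g⟩
  refine ⟨t, ht, hm.1, hm.2, fun u hu hu0 => ?_⟩
  by_contra hS
  have := hmax (y := g + t + u)
    ⟨⟨S'.add_mem hm.1 hu, hS⟩, t + u, S'.add_mem ht hu, (add_assoc _ _ _).symm⟩ (by omega)
  omega

theorem card_gaps_lower_bound (S S' : AddSubmonoid ℕ) (hSS' : S ≤ S')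
    (hgcd : EquiGcd S S') (w : ℕ) (hw : frobSet S S' = {w}) :
    Nat.card (gapSet S S') ≥
      Nat.card (sporadicSet S S') + Nat.card (pseudoFrobSet S S') - 1 := by
  have hfin := hgcd.finite_gapSet
  have hle : ∀ g ∈ gapSet S S', ∃ t ∈ S', g + t = w := fun g hg => by
    simpa [hw] using exists_add_mem_frobSet hfin hg
  obtain ⟨hwS', hwS, hwadd⟩ : w ∈ frobSet S S' := hw ▸ Set.mem_singleton w
  have hsp : ∀ a ∈ sporadicSet S S', ∃ g ∈ S', a + g = w := by
    rintro a ⟨ha, t, ht, hat⟩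
    obtain ⟨u, hu, rfl⟩ := hle (a + t) ⟨S'.add_mem (hSS' ha) ht, hat⟩
    exact ⟨t + u, S'.add_mem ht hu, (add_assoc _ _ _).symm⟩
  have hinj : Set.InjOn (w - ·) (sporadicSet S S') := fun a ha b hb hab => by
    obtain ⟨g, -, hg⟩ := hsp a ha
    obtain ⟨g', -, hg'⟩ := hsp b hb
    dsimp only at hab
    omega
  have hsub : (w - ·) '' sporadicSet S S' ⊆ gapSet S S' := by
    rintro _ ⟨a, ha, rfl⟩
    obtain ⟨g, hg, rfl⟩ := hsp a ha
    simp only [add_tsub_cancel_left]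
    exact ⟨hg, fun hgS => hwS (S.add_mem ha.1 hgS)⟩
  have hPF : pseudoFrobSet S S' ⊆ gapSet S S' := fun p hp => ⟨hp.1, hp.2.1⟩
  have hwPF : w ∈ pseudoFrobSet S S' := ⟨hwS', hwS, fun s hs => hwadd s (hSS' hs)⟩
  have hdisj : Disjoint ((w - ·) '' sporadicSet S S') (pseudoFrobSet S S' \ {w}) := by
    rw [Set.disjoint_left]
    rintro _ ⟨a, ha, rfl⟩ ⟨hp, hne⟩
    obtain ⟨g, -, rfl⟩ := hsp a ha
    simp only [add_tsub_cancel_left, Set.mem_singleton_iff] at hp hne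
    exact hwS (add_comm g a ▸ hp.2.2 a ha.1 (by omega))
  have hcard := Set.ncard_le_ncard
    (Set.union_subset hsub (Set.sdiff_subset.trans hPF : pseudoFrobSet S S' \ {w} ⊆ _)) hfin
  rw [Set.ncard_union_eq hdisj (hfin.subset hsub) (hfin.subset (Set.sdiff_subset.trans hPF)),
    hinj.ncard_image, Set.ncard_sdiff_singleton_of_mem hwPF] at hcard
  simp only [Nat.card_coe_set_eq]
  omega
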